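/- Let $X$ be a reflexive Banach space and let $\{(x_j, x_j^*)\}_{j=1}^\infty$ be an unconditional Schauder frame in $X$. Then $\{(x_j^*, x_j)\}_{j=1}^\infty$ is an unconditional Schauder frame for the dual space $X^*$, i.e., every $x^* \in X^*$ satisfies $x^* = \sum_{j=1}^\infty x^*(x_j) x_j^*$ with unconditional convergence in $X^*$. -/

import Mathlib

theorem dual_unconditional_frame
    (X : Type*) [NormedAddCommGroup X] [NormedSpace ℝ X] [CompleteSpace X]
    (hrefl : Function.Surjective (NormedSpace.inclusionInDoubleDual ℝ X))
    (x : ℕ → X) (xs : ℕ → (X →L[ℝ] ℝ))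
    (hframe : ∀ v : X, HasSum (fun j => xs j v • x j) v) :
    ∀ xstar : X →L[ℝ] ℝ, HasSum (fun j => xstar (x j) • xs j) xstar := by
  intro xstar
  set f : ℕ → (X →L[ℝ] ℝ) := fun j => xstar (x j) • xs j with hf
  have hsum : ∀ v, HasSum (fun j => f j v) (xstar v) := by
    intro v
    have h := xstar.hasSum (hframe v)
    refine h.congr_fun ?_ |> fun h => h
    intro j
    simp [hf, mul_comm]
  have habs : ∀ v, Summable (fun j => ‖f j v‖) := fun v => (hsum v).summable.norm
  -- subset sums
  have hex : ∀ A : ℕ → Bool, ∃ g : X →L[ℝ] ℝ, ∀ v,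
      HasSum (fun j => if A j then f j v else 0) (g v) := by
    intro A
    have hs : ∀ v, Summable (fun j => if A j then f j v else 0) := by
      intro v
      refine Summable.of_norm_bounded (habs v) ?_
      intro j
      split_ifs <;> simp
    let G : Finset ℕ → (X →L[ℝ] ℝ) := fun s => ∑ j ∈ s, if A j then f j else 0
    have hG : Filter.Tendsto (fun s v => G s v) Filter.atTop
        (nhds (fun v => ∑' j, if A j then f j v else 0)) := by
      rw [tendsto_pi_nhds]
      intro v
      have h := (hs v).hasSum
      refine Filter.Tendsto.congr ?_ h
      intro s
      simp only [G, ContinuousLinearMap.sum_apply]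
      refine Finset.sum_congr rfl fun j _ => ?_
      split_ifs <;> simp
    refine ⟨continuousLinearMapOfTendsto G hG, fun v => (hs v).hasSum⟩
  choose Φ hΦ using hex
  have hcont : ∀ v, Continuous (fun A => Φ A v) := by
    intro v
    have : (fun A => Φ A v) = fun A : ℕ → Bool => ∑' j, if A j then f j v else 0 := by
      funext A
      exact (hΦ A v).tsum_eq.symm
    rw [this]
    refine continuous_tsum (u := fun j => ‖f j v‖) ?_ (habs v) ?_
    · intro j
      exact (continuous_of_discreteTopology (f := fun b : Bool => if b then f j v else 0)).comp
        (continuous_apply j)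
    · intro j A
      split_ifs <;> simp
  let M : Submodule ℝ (X →L[ℝ] ℝ) := (Submodule.span ℝ (Set.range f)).topologicalClosure
  have hM : ∀ A, Φ A ∈ M := by
    intro A
    by_contra hA
    obtain ⟨F, u, hFu, hu⟩ := geometric_hahn_banach_closed_point (E := X →L[ℝ] ℝ)
      (s := (M : Set (X →L[ℝ] ℝ))) M.convex
      (Submodule.isClosed_topologicalClosure _) hA
    have hz : ∀ m ∈ M, F m = 0 := by
      intro m hm
      by_contra hne
      have := hFu (((u + 1) / F m) • m) (M.smul_mem _ hm)
      rw [map_smul, smul_eq_mul, div_mul_cancel₀ _ hne] at this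
      linarith
    obtain ⟨v, rfl⟩ := hrefl F
    have h0 : ∀ j, f j v = 0 := fun j =>
      hz (f j) (Submodule.le_topologicalClosure _ (Submodule.subset_span ⟨j, rfl⟩))
    have h1 : Φ A v = 0 := by
      have h := hΦ A v
      simp only [h0, ite_self] at h
      exact h.unique hasSum_zero
    have h2 := hFu 0 M.zero_mem
    rw [map_zero] at h2
    have h3 : u < Φ A v := hu
    linarith
  have hsep : TopologicalSpace.IsSeparable (M : Set (X →L[ℝ] ℝ)) := by
    have h := ((Set.countable_range f).isSeparable.span (R := ℝ)).closure
    simpa [M, Submodule.topologicalClosure_coe] using h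
  obtain ⟨c, hc, hMc⟩ := hsep
  have hsummable : Summable f := by
    rw [summable_iff_vanishing_norm]
    intro ε hε
    have hclosed : ∀ d : c, IsClosed {A : ℕ → Bool | ‖Φ A - d.1‖ ≤ ε / 3} := by
      intro d
      have : {A : ℕ → Bool | ‖Φ A - d.1‖ ≤ ε / 3}
          = ⋂ v : X, {A | ‖Φ A v - d.1 v‖ ≤ ε / 3 * ‖v‖} := by
        ext A
        simp only [Set.mem_setOf_eq, Set.mem_iInter]
        rw [ContinuousLinearMap.opNorm_le_iff (by positivity)]
        rfl
      rw [this]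
      exact isClosed_iInter fun v =>
        isClosed_le ((hcont v).sub continuous_const).norm continuous_const
    have hcover : ⋃ d : c, {A : ℕ → Bool | ‖Φ A - d.1‖ ≤ ε / 3} = Set.univ := by
      rw [Set.eq_univ_iff_forall]
      intro A
      obtain ⟨d, hd, hdist⟩ := Metric.mem_closure_iff.1 (hMc (hM A)) (ε / 3) (by positivity)
      rw [dist_eq_norm] at hdist
      exact Set.mem_iUnion.2 ⟨⟨d, hd⟩, hdist.le⟩
    haveI := hc.to_subtype
    obtain ⟨d, A₀, hA₀⟩ := nonempty_interior_of_iUnion_of_closed hclosed hcover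
    rw [mem_interior_iff_mem_nhds, nhds_pi, Filter.mem_pi'] at hA₀
    obtain ⟨I, t, ht, hI⟩ := hA₀
    refine ⟨I, fun s hs => ?_⟩
    have key : ∀ b : Bool, ‖Φ (fun j => if j ∈ s then b else A₀ j) - d.1‖ ≤ ε / 3 := by
      intro b
      apply hI
      intro j hj
      have : j ∉ s := fun h => Finset.disjoint_left.1 hs h hj
      simp only [this, if_false]
      exact mem_of_mem_nhds (ht j)
    have hdiff : ∑ j ∈ s, f j = Φ (fun j => if j ∈ s then true else A₀ j)
        - Φ (fun j => if j ∈ s then false else A₀ j) := by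
      ext v
      have h := (hΦ (fun j => if j ∈ s then true else A₀ j) v).sub
        (hΦ (fun j => if j ∈ s then false else A₀ j) v)
      have h' : HasSum (fun j => if j ∈ s then f j v else 0) (∑ j ∈ s, f j v) := by
        have := hasSum_sum_of_ne_finset_zero (f := fun j => if j ∈ s then f j v else 0) (s := s)
          (L := SummationFilter.unconditional ℕ) (by intro j hj; simp [hj])
        rwa [Finset.sum_congr rfl (fun j hj => if_pos hj)] at this
      rw [ContinuousLinearMap.sum_apply, ContinuousLinearMap.sub_apply]
      refine h'.unique ?_
      refine h.congr_fun ?_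
      intro j
      by_cases hj : j ∈ s <;> simp [hj]
    rw [hdiff]
    have e := norm_sub_le_norm_sub_add_norm_sub
      (Φ (fun j => if j ∈ s then true else A₀ j)) d.1 (Φ (fun j => if j ∈ s then false else A₀ j))
    have e1 := key true
    have e2 := key false
    rw [norm_sub_rev] at e2
    linarith
  have hfin : ∑' j, f j = xstar := by
    ext v
    have h := (ContinuousLinearMap.apply ℝ ℝ v).hasSum hsummable.hasSum
    exact h.unique (hsum v)
  rw [← hfin]
  exact hsummable.hasSum
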